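/- arXiv:1407.3894 — 2 statements merged into one kernel-verified Lean document; each statement's English description precedes it below -/
import Mathlib

section
/- Let $D, T \in \mathbb{R}^{m \times n}$, let $Y \in \mathbb{R}^{n \times r}$ satisfy $Y^T Y = I_r$, and let $S \in \mathbb{R}^{r \times r}$ be a diagonal matrix with nonzero diagonal entries. Set $A = D^T D$, $B = T^T T$, $C = D^T T + T^T D$, $X = Y S^2 Y^T$ and $X^{\dagger} = Y S^{-2} Y^T$. Then $\mathrm{tr}\big((D X - T)^T (D - T X^{\dagger})\, Y Y^T\big) = \mathrm{tr}\big(Y^T A Y S^2 - Y^T C Y + Y^T B Y S^{-2}\big)$. -/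
open Matrix

/-- the total error `tr((DX - T)ᵀ (D - TX†) Y Yᵀ)` equals
`tr(Yᵀ A Y S² - Yᵀ C Y + Yᵀ B Y S⁻²)`. -/
theorem stmt3 (m n r : ℕ) (D T : Matrix (Fin m) (Fin n) ℝ)
    (Y : Matrix (Fin n) (Fin r) ℝ) (hY : Yᵀ * Y = 1)
    (s : Fin r → ℝ) (hs : ∀ i, s i ≠ 0)
    (A : Matrix (Fin n) (Fin n) ℝ) (hA : A = Dᵀ * D)
    (B : Matrix (Fin n) (Fin n) ℝ) (hB : B = Tᵀ * T)
    (C : Matrix (Fin n) (Fin n) ℝ) (hC : C = Dᵀ * T + Tᵀ * D)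
    (X Xd : Matrix (Fin n) (Fin n) ℝ)
    (hX : X = Y * diagonal (fun i => (s i) ^ 2) * Yᵀ)
    (hXd : Xd = Y * diagonal (fun i => ((s i) ^ 2)⁻¹) * Yᵀ) :
    trace ((D * X - T)ᵀ * (D - T * Xd) * (Y * Yᵀ))
      = trace (Yᵀ * A * Y * diagonal (fun i => (s i) ^ 2)
          - Yᵀ * C * Y
          + Yᵀ * B * Y * diagonal (fun i => ((s i) ^ 2)⁻¹)) := by
  set P := diagonal (fun i => (s i) ^ 2) with hP
  set Q := diagonal (fun i => ((s i) ^ 2)⁻¹) with hQ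
  have hQP : Q * P = 1 := by
    rw [hQ, hP, diagonal_mul_diagonal, ← diagonal_one]
    exact congrArg diagonal (funext fun i => inv_mul_cancel₀ (pow_ne_zero 2 (hs i)))
  have cancel {k : ℕ} (M : Matrix (Fin r) (Fin k) ℝ) : Yᵀ * (Y * M) = M := by
    rw [← Matrix.mul_assoc, hY, Matrix.one_mul]
  have hXt : Xᵀ = X := by
    simp [hX, hP, transpose_mul, Matrix.mul_assoc]
  have hYX : Y * Yᵀ * X = X := by
    simp only [hX, Matrix.mul_assoc, cancel]
  have hXdY : Xd * (Y * Yᵀ) = Xd := by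
    simp only [hXd, Matrix.mul_assoc, cancel]
  have hXdX : Xd * X = Y * Yᵀ := by
    simp only [hXd, hX, Matrix.mul_assoc, cancel]
    rw [← Matrix.mul_assoc Q, hQP, Matrix.one_mul]
  have conj (M : Matrix (Fin n) (Fin n) ℝ) (N : Matrix (Fin r) (Fin r) ℝ) :
      trace (Yᵀ * M * Y * N) = trace (M * (Y * N * Yᵀ)) := by
    rw [Matrix.mul_assoc, Matrix.mul_assoc, trace_mul_comm, Matrix.mul_assoc]
  have conj_one (M : Matrix (Fin n) (Fin n) ℝ) :
      trace (Yᵀ * M * Y) = trace (M * (Y * Yᵀ)) := by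
    simpa using conj M 1
  have expand : (D * X - T)ᵀ * (D - T * Xd) * (Y * Yᵀ)
      = X * (A * (Y * Yᵀ)) - X * (Dᵀ * T * Xd) - Tᵀ * D * (Y * Yᵀ) + B * Xd := by
    rw [transpose_sub, transpose_mul, hXt, Matrix.mul_assoc, Matrix.sub_mul D,
      Matrix.mul_assoc T, hXdY, hA, hB]
    simp only [Matrix.sub_mul, Matrix.mul_sub, Matrix.mul_assoc]
    abel
  have hAX : trace (X * (A * (Y * Yᵀ))) = trace (A * X) := by
    rw [trace_mul_comm, Matrix.mul_assoc, hYX]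
  have hDT : trace (X * (Dᵀ * T * Xd)) = trace (Dᵀ * T * (Y * Yᵀ)) := by
    rw [trace_mul_comm, Matrix.mul_assoc, hXdX]
  rw [expand, trace_add, trace_sub, trace_sub, hAX, hDT, trace_add, trace_sub, conj, conj,
    conj_one, ← hX, ← hXd, hC, Matrix.add_mul, trace_add]
  ring
end

section
/- Let $D, T \in \mathbb{R}^{m \times n}$ and set $A = D^T D$, $B = T^T T$, $C = D^T T + T^T D$. Fix a diagonal matrix $S = \mathrm{diag}(s_1, \dots, s_r)$ with all $s_i > 0$ such that for each $i$ the matrix $s_i^2 D - T$ has rank $n$. Then the function $Y \mapsto \mathrm{tr}(Y^T A Y S^2 - Y^T C Y + Y^T B Y S^{-2})$ is strictly convex on $\mathbb{R}^{n \times r}$. -/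
open Matrix

/-- A real matrix whose rank equals its number of columns has injective `mulVec`. -/
theorem mulVec_injective_of_rank_eq_card {m n : Type*} [Fintype m] [Fintype n]
    {M : Matrix m n ℝ} (h : M.rank = Fintype.card n) : Function.Injective M.mulVec := by
  rw [Matrix.mulVec_injective_iff, linearIndependent_iff_card_eq_finrank_span, ← h,
    Matrix.rank_eq_finrank_span_cols]
  rfl

/-- The squared Frobenius norm of an injective linear matrix-valued map is strictly convex. -/
theorem strictConvexOn_trace_transpose_mul_self {E m n : Type*} [AddCommGroup E] [Module ℝ E]
    [Fintype m] [Fintype n] (L : E →ₗ[ℝ] Matrix m n ℝ) (hL : Function.Injective L) :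
    StrictConvexOn ℝ Set.univ (fun x => trace ((L x)ᵀ * L x)) := by
  refine ⟨convex_univ, fun x _ y _ hxy a b ha hb hab => ?_⟩
  have hne : L x - L y ≠ 0 := sub_ne_zero.2 (hL.ne hxy)
  have hpos : 0 < trace ((L x - L y)ᵀ * (L x - L y)) := by
    rw [← conjTranspose_eq_transpose_of_trivial]
    exact (posSemidef_conjTranspose_mul_self _).trace_nonneg.lt_of_ne'
      (trace_conjTranspose_mul_self_eq_zero_iff.not.2 hne)
  obtain rfl : b = 1 - a := by linarith
  have hprod := mul_pos (mul_pos ha hb) hpos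
  simp only [map_add, map_smul, transpose_add, transpose_sub, transpose_smul, Matrix.add_mul,
    Matrix.mul_add, Matrix.sub_mul, Matrix.mul_sub, Matrix.smul_mul, Matrix.mul_smul, trace_add, trace_sub, trace_smul, smul_eq_mul]
    at hprod ⊢
  linarith

/-- The trace of the quadratic form is a squared Frobenius norm. -/
theorem trace_quadratic_eq {m n r : Type*} [Fintype m] [Fintype n] [Fintype r] [DecidableEq r]
    (D T : Matrix m n ℝ) (s : r → ℝ) (hs : ∀ i, s i ≠ 0) (Y : Matrix n r ℝ) :
    trace (Yᵀ * (Dᵀ * D) * Y * diagonal (fun i => s i ^ 2) - Yᵀ * (Dᵀ * T + Tᵀ * D) * Y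
        + Yᵀ * (Tᵀ * T) * Y * diagonal (fun i => (s i ^ 2)⁻¹)) =
      trace ((D * Y * diagonal s - T * Y * diagonal s⁻¹)ᵀ *
        (D * Y * diagonal s - T * Y * diagonal s⁻¹)) := by
  have hcycle (P Q : Matrix m r ℝ) (u v : r → ℝ) :
      trace ((P * diagonal u)ᵀ * (Q * diagonal v)) =
        trace (Pᵀ * Q * diagonal (fun i => v i * u i)) := by
    rw [transpose_mul, diagonal_transpose, Matrix.mul_assoc, trace_mul_comm, Matrix.mul_assoc,
      Matrix.mul_assoc, diagonal_mul_diagonal, Matrix.mul_assoc]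
  have h₁ : (fun i => s i * s⁻¹ i) = fun _ => 1 := funext fun i => mul_inv_cancel₀ (hs i)
  have h₂ : (fun i => s⁻¹ i * s i) = fun _ => 1 := funext fun i => inv_mul_cancel₀ (hs i)
  simp only [transpose_sub, Matrix.sub_mul, Matrix.mul_sub, trace_sub, hcycle, h₁, h₂,
    diagonal_one, Matrix.mul_one, ← pow_two]
  simp only [transpose_mul, Matrix.mul_assoc, Matrix.add_mul, Matrix.mul_add, trace_add, trace_sub,
    Pi.inv_apply, inv_pow]
  ring

/-- for a fixed positive diagonal `S` with every `sᵢ² D - T` of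
full column rank, `Y ↦ tr(Yᵀ A Y S² - Yᵀ C Y + Yᵀ B Y S⁻²)` is strictly
convex on `ℝ^{n×r}`. -/
theorem stmt17 (m n r : ℕ) (D T : Matrix (Fin m) (Fin n) ℝ)
    (A : Matrix (Fin n) (Fin n) ℝ) (hA : A = Dᵀ * D)
    (B : Matrix (Fin n) (Fin n) ℝ) (hB : B = Tᵀ * T)
    (C : Matrix (Fin n) (Fin n) ℝ) (hC : C = Dᵀ * T + Tᵀ * D)
    (s : Fin r → ℝ) (hs : ∀ i, 0 < s i)
    (hrank : ∀ i, ((s i) ^ 2 • D - T).rank = n) :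
    StrictConvexOn ℝ Set.univ
      (fun Y : Matrix (Fin n) (Fin r) ℝ =>
        trace (Yᵀ * A * Y * diagonal (fun i => (s i) ^ 2)
          - Yᵀ * C * Y
          + Yᵀ * B * Y * diagonal (fun i => ((s i) ^ 2)⁻¹))) := by
  subst hA hB hC
  simp only [trace_quadratic_eq D T s fun i => (hs i).ne']
  let L : Matrix (Fin n) (Fin r) ℝ →ₗ[ℝ] Matrix (Fin m) (Fin r) ℝ :=
    { toFun := fun Y => D * Y * diagonal s - T * Y * diagonal s⁻¹
      map_add' := fun Y Z => by simp only [Matrix.mul_add, Matrix.add_mul]; abel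
      map_smul' := fun c Y => by simp [smul_sub] }
  refine strictConvexOn_trace_transpose_mul_self L ((injective_iff_map_eq_zero L).2 fun Y hY => ?_)
  have hcol (i : Fin r) : Y.col i = 0 := by
    refine mulVec_injective_of_rank_eq_card ((hrank i).trans (Fintype.card_fin n).symm) ?_
    rw [mulVec_zero]
    ext k
    have hk : (D * Y) k i * s i - (T * Y) k i * (s i)⁻¹ = 0 := by
      simpa [L] using congrFun₂ hY k i
    have hsi := (hs i).ne'
    have hk' : s i ^ 2 * (D * Y) k i - (T * Y) k i = 0 := by
      field_simp at hk
      linarith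
    rw [sub_mulVec, smul_mulVec]
    exact hk'
  ext k i
  exact congrFun (hcol i) k
end
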